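/- The functional J_s satisfies the Palais–Smale condition on S: if (u_k) ⊂ S, (t_k) ⊂ ℝ and (η_k) ⊂ ℝ with η_k → 0 are such that |J_s(u_k)| ≤ K for some K > 0 and, for every k and every v ∈ W^{α,p}, |Λ_{n,p}(1−α)H_{α,p}(u_k, v) + ∫_Ω |u_k|^{p−2}u_k v dx − (s/ε)∫_{Ω_ε}(u_k⁺)^{p−1} v dx − (t_k/ε)∫_{Ω_ε}|u_k|^{p−2}u_k v dx| ≤ η_k ‖v‖_{α,p}, then (u_k) possesses a subsequence converging strongly in W^{α,p} (with respect to ‖·‖_{α,p}). -/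

import Mathlib

open MeasureTheory Real Set Filter Topology

noncomputable section

/-- Points of `ℝ^n`. -/
abbrev Pt (n : ℕ) := EuclideanSpace ℝ (Fin n)

/-- The normalizing constant `Λ_{n,p} = p Γ((n+p)/2) / (2 π^{(n-1)/2} Γ((p+1)/2))`. -/
def Lam (n : ℕ) (p : ℝ) : ℝ :=
  p * Real.Gamma (((n : ℝ) + p) / 2) /
    (2 * Real.pi ^ (((n : ℝ) - 1) / 2) * Real.Gamma ((p + 1) / 2))

variable {n : ℕ}

/-- `Q = ℝ^{2n} \ (Ω^c × Ω^c)`. -/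
def Qset (Ω : Set (Pt n)) : Set (Pt n × Pt n) := (Ωᶜ ×ˢ Ωᶜ)ᶜ

/-- The singular kernel `|x - y|^{-(n + pα)}`. -/
def kern (p α : ℝ) (z : Pt n × Pt n) : ℝ := ‖z.1 - z.2‖ ^ (-((n : ℝ) + p * α))

/-- The `p`-th power of the Gagliardo-type seminorm, `[u]_{α,p}^p`. -/
def gagP (p α : ℝ) (Ω : Set (Pt n)) (u : Pt n → ℝ) : ℝ :=
  ∫ z in Qset Ω, |u z.1 - u z.2| ^ p * kern p α z

/-- The nonlinear form `H_{α,p}(u,v)`. -/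
def Hform (p α : ℝ) (Ω : Set (Pt n)) (u v : Pt n → ℝ) : ℝ :=
  ∫ z in Qset Ω,
    |u z.1 - u z.2| ^ (p - 2) * (u z.1 - u z.2) * (v z.1 - v z.2) * kern p α z

/-- `∫_Ω |u|^p`. -/
def lpP (p : ℝ) (Ω : Set (Pt n)) (u : Pt n → ℝ) : ℝ := ∫ x in Ω, |u x| ^ p

/-- Membership in the space `W^{α,p}`: measurable with finite norm `‖u‖_{α,p}`. -/
def memW (p α : ℝ) (Ω : Set (Pt n)) (u : Pt n → ℝ) : Prop :=
  Measurable u ∧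
    ((∫⁻ x in Ω, ENNReal.ofReal (|u x| ^ p)) +
      ∫⁻ z in Qset Ω, ENNReal.ofReal (|u z.1 - u z.2| ^ p * kern p α z)) < ⊤

/-- The norm `‖u‖_{α,p} = (‖u‖_{L^p(Ω)}^p + [u]_{α,p}^p)^{1/p}`. -/
def normW (p α : ℝ) (Ω : Set (Pt n)) (u : Pt n → ℝ) : ℝ :=
  (lpP p Ω u + gagP p α Ω u) ^ (1 / p)

/-- `Ω_ε = {x ∈ Ω : dist(x, ∂Ω) ≤ ε}`. -/
def Oeps (Ω : Set (Pt n)) (ε : ℝ) : Set (Pt n) :=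
  {x ∈ Ω | Metric.infDist x (frontier Ω) ≤ ε}

/-- The energy `Λ_{n,p}(1-α)[u]_{α,p}^p + ∫_Ω |u|^p`. -/
def energy (p α : ℝ) (Ω : Set (Pt n)) (u : Pt n → ℝ) : ℝ :=
  Lam n p * (1 - α) * gagP p α Ω u + lpP p Ω u

/-- The constraint sphere `S = {u ∈ W^{α,p} : (1/ε)∫_{Ω_ε}|u|^p = 1}`. -/
def sphereS (p α ε : ℝ) (Ω : Set (Pt n)) (u : Pt n → ℝ) : Prop :=
  memW p α Ω u ∧ (1 / ε) * ∫ x in Oeps Ω ε, |u x| ^ p = 1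

/-- The first eigenvalue `λ_{1,ε}`. -/
def lam1 (p α ε : ℝ) (Ω : Set (Pt n)) : ℝ :=
  sInf {r | ∃ u, sphereS p α ε Ω u ∧ r = energy p α Ω u}

/-- Positive part `u⁺`. -/
def pPart (u : Pt n → ℝ) (x : Pt n) : ℝ := max (u x) 0

/-- Negative part `u⁻`. -/
def nPart (u : Pt n → ℝ) (x : Pt n) : ℝ := max (-u x) 0

/-- The functional `J_s`. -/
def Jfun (p α ε s : ℝ) (Ω : Set (Pt n)) (u : Pt n → ℝ) : ℝ :=
  energy p α Ω u - (s / ε) * ∫ x in Oeps Ω ε, pPart u x ^ p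

/-- Weak solution of the Fučik problem `(F_p)` with parameters `(a,b)`. -/
def isWeakSol (p α ε a b : ℝ) (Ω : Set (Pt n)) (u : Pt n → ℝ) : Prop :=
  memW p α Ω u ∧ ∀ v, memW p α Ω v →
    Lam n p * (1 - α) * Hform p α Ω u v + (∫ x in Ω, |u x| ^ (p - 2) * u x * v x)
      = (a / ε) * (∫ x in Oeps Ω ε, pPart u x ^ (p - 1) * v x)
        - (b / ε) * ∫ x in Oeps Ω ε, nPart u x ^ (p - 1) * v x

/-- The Fučik spectrum `Σ_p`. -/
def SigmaP (p α ε : ℝ) (Ω : Set (Pt n)) : Set (ℝ × ℝ) :=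
  {ab | ∃ u : Pt n → ℝ, isWeakSol p α ε ab.1 ab.2 Ω u ∧ ¬ (∀ᵐ x : Pt n, u x = 0)}

/-- Continuity of a path `γ : [-1,1] → W^{α,p}` with respect to `‖·‖_{α,p}`. -/
def contPathW (p α : ℝ) (Ω : Set (Pt n)) (γ : ℝ → Pt n → ℝ) : Prop :=
  ∀ t ∈ Icc (-1 : ℝ) 1, ∀ δ > (0 : ℝ), ∃ η > (0 : ℝ), ∀ t' ∈ Icc (-1 : ℝ) 1,
    |t' - t| < η → normW p α Ω (γ t' - γ t) < δ

/-- The family of paths `Γ` on `S` joining `-φ₁` to `φ₁`. -/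
def GammaSet (p α ε : ℝ) (Ω : Set (Pt n)) (φ : Pt n → ℝ) : Set (ℝ → Pt n → ℝ) :=
  {γ | (∀ t ∈ Icc (-1 : ℝ) 1, sphereS p α ε Ω (γ t)) ∧ contPathW p α Ω γ ∧
    γ (-1) = -φ ∧ γ 1 = φ}

/-- The minimax value `c(s)`. -/
def cval (p α ε : ℝ) (Ω : Set (Pt n)) (φ : Pt n → ℝ) (s : ℝ) : ℝ :=
  sInf {r | ∃ γ ∈ GammaSet p α ε Ω φ,
    r = sSup ((fun t => Jfun p α ε s Ω (γ t)) '' Icc (-1 : ℝ) 1)}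

/-- Topology on functions generated by the balls of the seminorm `‖·‖_{α,p}`. -/
def topW (p α : ℝ) (Ω : Set (Pt n)) : TopologicalSpace (Pt n → ℝ) :=
  TopologicalSpace.generateFrom
    {B | ∃ (u : Pt n → ℝ) (r : ℝ), B = {v | normW p α Ω (v - u) < r}}

/-- First eigenvalue with constraint on a subregion `D`. -/
def lam1On (p α ε : ℝ) (Ω D : Set (Pt n)) : ℝ :=
  sInf {r | ∃ u, memW p α Ω u ∧ (1 / ε) * (∫ x in D, |u x| ^ p) = 1 ∧
    r = energy p α Ω u}

/-- Primitive `F(x,s) = ∫_0^s f(x,t) dt`. -/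
def Ffun (f : Pt n → ℝ → ℝ) (x : Pt n) (s : ℝ) : ℝ := ∫ t in (0:ℝ)..s, f x t

/-- The energy functional `Ψ` of the nonresonance problem (`p = 2`). -/
def Psi (α ε : ℝ) (Ω : Set (Pt n)) (f : Pt n → ℝ → ℝ) (u : Pt n → ℝ) : ℝ :=
  Lam n 2 * (1 - α) / 2 * gagP 2 α Ω u + (1 / 2) * lpP 2 Ω u
    - (1 / ε) * ∫ x in Oeps Ω ε, Ffun f x (u x)

lemma ps_young {p a b d : ℝ} (hp : 2 ≤ p) (hd : 0 < d) :
    |a| ^ (p - 1) * |b| ≤ d * |a| ^ p + d ^ (1 - p) * |b| ^ p := by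
  have ha := abs_nonneg a
  have hb := abs_nonneg b
  have e : ∀ x : ℝ, 0 ≤ x → x ^ p = x ^ (p - 1) * x := by
    intro x hx
    rw [← Real.rpow_add_one' hx (by linarith)]; congr 1; ring
  have h1 : 0 ≤ d ^ (1 - p) * |b| ^ p := by positivity
  have h2 : 0 ≤ d * |a| ^ p := by positivity
  rcases le_total |b| (d * |a|) with h | h
  · have : |a| ^ (p - 1) * |b| ≤ |a| ^ (p - 1) * (d * |a|) := by gcongr
    have h3 := e _ ha
    nlinarith
  · have h4 : (d * |a|) ^ (p - 1) ≤ |b| ^ (p - 1) :=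
      Real.rpow_le_rpow (by positivity) h (by linarith)
    rw [Real.mul_rpow hd.le ha] at h4
    have h5 : d ^ (1 - p) * d ^ (p - 1) = 1 := by
      rw [← Real.rpow_add hd]; simp
    have h6 : |a| ^ (p - 1) ≤ d ^ (1 - p) * |b| ^ (p - 1) := by
      calc |a| ^ (p - 1) = d ^ (1 - p) * (d ^ (p - 1) * |a| ^ (p - 1)) := by
            rw [← mul_assoc, h5, one_mul]
        _ ≤ _ := by gcongr
    have h7 := e _ hb
    calc |a| ^ (p - 1) * |b| ≤ (d ^ (1 - p) * |b| ^ (p - 1)) * |b| := by gcongr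
      _ = d ^ (1 - p) * |b| ^ p := by rw [h7]; ring
      _ ≤ _ := by linarith

lemma ps_add {p a b : ℝ} (hp : 2 ≤ p) :
    |a - b| ^ p ≤ 2 ^ p * (|a| ^ p + |b| ^ p) := by
  have h0 : |a - b| ≤ 2 * max |a| |b| := by
    have := abs_sub a b
    have h1 := le_max_left |a| |b|
    have h2 := le_max_right |a| |b|
    linarith
  calc |a - b| ^ p ≤ (2 * max |a| |b|) ^ p := Real.rpow_le_rpow (abs_nonneg _) h0 (by linarith)
    _ = 2 ^ p * (max |a| |b|) ^ p := Real.mul_rpow (by norm_num) (by positivity)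
    _ ≤ _ := by
      gcongr
      rcases le_total |a| |b| with h | h
      · rw [max_eq_right h]
        have : 0 ≤ |a| ^ p := by positivity
        linarith
      · rw [max_eq_left h]
        have : 0 ≤ |b| ^ p := by positivity
        linarith

lemma ps_mono {p a b : ℝ} (hp : 2 ≤ p) :
    2 ^ (1 - p) * |a - b| ^ p ≤
      (|a| ^ (p - 2) * a - |b| ^ (p - 2) * b) * (a - b) := by
  have h2 : (0 : ℝ) < 2 := by norm_num
  have key : (|a - b| / 2) ^ (p - 2) ≤ |a| ^ (p - 2) + |b| ^ (p - 2) := by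
    have h0 : |a - b| / 2 ≤ max |a| |b| := by
      have := abs_sub a b
      have h1 := le_max_left |a| |b|
      have h2 := le_max_right |a| |b|
      linarith
    have h1 : (|a - b| / 2) ^ (p - 2) ≤ (max |a| |b|) ^ (p - 2) :=
      Real.rpow_le_rpow (by positivity) h0 (by linarith)
    have : 0 ≤ |a| ^ (p - 2) := by positivity
    have : 0 ≤ |b| ^ (p - 2) := by positivity
    rcases le_total |a| |b| with h | h
    · rw [max_eq_right h] at h1
      linarith
    · rw [max_eq_left h] at h1
      linarith
  have hm : 0 ≤ (|a| ^ (p - 2) - |b| ^ (p - 2)) * (a ^ 2 - b ^ 2) := by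
    rcases le_total |a| |b| with h | h
    · have h1 : |a| ^ (p - 2) ≤ |b| ^ (p - 2) :=
        Real.rpow_le_rpow (by positivity) h (by linarith)
      exact mul_nonneg_of_nonpos_of_nonpos (by linarith) (by linarith [sq_le_sq.2 h])
    · have h1 : |b| ^ (p - 2) ≤ |a| ^ (p - 2) :=
        Real.rpow_le_rpow (by positivity) h (by linarith)
      exact mul_nonneg (by linarith) (by linarith [sq_le_sq.2 h])
  have e : 2 ^ (1 - p) * |a - b| ^ p = (1 / 2) * ((|a - b| / 2) ^ (p - 2) * (a - b) ^ 2) := by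
    have h3 : |a - b| ^ p = |a - b| ^ (p - 2) * |a - b| ^ 2 := by
      rw [← Real.rpow_add_natCast' (abs_nonneg _) (by push_cast; linarith)]
      congr 1; push_cast; ring
    have h4 : (2 : ℝ) ^ (1 - p) = (2 ^ (p - 2))⁻¹ * (1 / 2) := by
      rw [← Real.rpow_neg h2.le, show (1 / 2 : ℝ) = 2 ^ (-1 : ℝ) by
        rw [Real.rpow_neg_one]; norm_num, ← Real.rpow_add h2]
      congr 1; ring
    rw [h3, sq_abs, h4, Real.div_rpow (abs_nonneg _) h2.le]
    field_simp
  rw [e]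
  have h5 : (|a - b| / 2) ^ (p - 2) * (a - b) ^ 2 ≤
      (|a| ^ (p - 2) + |b| ^ (p - 2)) * (a - b) ^ 2 := by gcongr
  nlinarith

lemma ps_absg {p a : ℝ} (hp : 2 ≤ p) : |(|a| ^ (p - 2) * a)| = |a| ^ (p - 1) := by
  rw [abs_mul, abs_of_nonneg (by positivity : 0 ≤ |a| ^ (p - 2)),
    ← Real.rpow_add_one' (abs_nonneg _) (by linarith)]
  congr 1; ring

lemma ps_gmul {p a : ℝ} (hp : 2 ≤ p) : |a| ^ (p - 2) * a * a = |a| ^ p := by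
  rw [mul_assoc, ← abs_mul_abs_self a, ← mul_assoc, 
    ← Real.rpow_add_one' (abs_nonneg _) (by linarith),
    ← Real.rpow_add_one' (abs_nonneg _) (by linarith)]
  congr 1; ring

lemma ps_ppow {p : ℝ} (hp : 2 ≤ p) (u : Pt n → ℝ) (x : Pt n) :
    pPart u x ^ (p - 1) * u x = pPart u x ^ p := by
  unfold pPart
  rcases le_total (u x) 0 with h | h
  · rw [max_eq_right h, Real.zero_rpow (by linarith), Real.zero_rpow (by linarith), zero_mul]
  · rw [max_eq_left h, ← Real.rpow_add_one' h (by linarith)]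
    congr 1; ring

lemma ps_ple (u : Pt n → ℝ) (x : Pt n) : 0 ≤ pPart u x ∧ pPart u x ≤ |u x| := by
  unfold pPart
  exact ⟨le_max_right _ _, max_le (le_abs_self _) (abs_nonneg _)⟩

lemma ps_kern_nonneg (p α : ℝ) (z : Pt n × Pt n) : 0 ≤ kern p α z := by
  unfold kern; positivity

lemma ps_kern_meas (p α : ℝ) : Measurable (kern p α : Pt n × Pt n → ℝ) := by
  unfold kern; fun_prop

/-- lintegral versions of the two parts of the norm -/
def AA (p : ℝ) (Ω : Set (Pt n)) (u : Pt n → ℝ) : ENNReal :=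
  ∫⁻ x in Ω, ENNReal.ofReal (|u x| ^ p)

def GG (p α : ℝ) (Ω : Set (Pt n)) (u : Pt n → ℝ) : ENNReal :=
  ∫⁻ z in Qset Ω, ENNReal.ofReal (|u z.1 - u z.2| ^ p * kern p α z)

lemma ps_lpP {p : ℝ} {Ω : Set (Pt n)} {u : Pt n → ℝ} (hu : Measurable u) :
    lpP p Ω u = (AA p Ω u).toReal := by
  unfold lpP AA
  rw [integral_eq_lintegral_of_nonneg_ae]
  · exact Filter.Eventually.of_forall fun x => by positivity
  · exact Measurable.aestronglyMeasurable (by fun_prop)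

lemma ps_gagP {p α : ℝ} {Ω : Set (Pt n)} {u : Pt n → ℝ} (hu : Measurable u) :
    gagP p α Ω u = (GG p α Ω u).toReal := by
  unfold gagP GG
  rw [integral_eq_lintegral_of_nonneg_ae]
  · exact Filter.Eventually.of_forall fun x =>
      mul_nonneg (by positivity) (ps_kern_nonneg _ _ _)
  · have := ps_kern_meas (n := n) p α
    exact Measurable.aestronglyMeasurable (by fun_prop)

lemma ps_memW {p α : ℝ} {Ω : Set (Pt n)} {u : Pt n → ℝ} :
    memW p α Ω u ↔ Measurable u ∧ AA p Ω u < ⊤ ∧ GG p α Ω u < ⊤ := by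
  unfold memW AA GG
  rw [ENNReal.add_lt_top]

lemma ps_intA {p α : ℝ} {Ω : Set (Pt n)} {u : Pt n → ℝ} (h : memW p α Ω u) :
    Integrable (fun x => |u x| ^ p) (volume.restrict Ω) := by
  have h' := ps_memW.1 h
  have hu := h'.1
  refine (lintegral_ofReal_ne_top_iff_integrable ?_ ?_).1 h'.2.1.ne
  · exact Measurable.aestronglyMeasurable (by fun_prop)
  · exact Filter.Eventually.of_forall fun x => by positivity

lemma ps_intG {p α : ℝ} {Ω : Set (Pt n)} {u : Pt n → ℝ} (h : memW p α Ω u) :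
    Integrable (fun z : Pt n × Pt n => |u z.1 - u z.2| ^ p * kern p α z)
      (volume.restrict (Qset Ω)) := by
  have h' := ps_memW.1 h
  have hu := h'.1
  have := ps_kern_meas (n := n) p α
  refine (lintegral_ofReal_ne_top_iff_integrable ?_ ?_).1 h'.2.2.ne
  · exact Measurable.aestronglyMeasurable (by fun_prop)
  · exact Filter.Eventually.of_forall fun x =>
      mul_nonneg (by positivity) (ps_kern_nonneg _ _ _)

lemma ps_AA_sub {p : ℝ} (hp : 2 ≤ p) {Ω : Set (Pt n)} {u v : Pt n → ℝ} (hu : Measurable u) :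
    AA p Ω (u - v) ≤ ENNReal.ofReal (2 ^ p) * (AA p Ω u + AA p Ω v) := by
  unfold AA
  rw [← lintegral_add_left (by fun_prop), ← lintegral_const_mul' _ _ ENNReal.ofReal_ne_top]
  refine lintegral_mono fun x => ?_
  rw [← ENNReal.ofReal_add (by positivity) (by positivity), ← ENNReal.ofReal_mul (by positivity)]
  exact ENNReal.ofReal_le_ofReal (ps_add hp)

lemma ps_GG_sub {p α : ℝ} (hp : 2 ≤ p) {Ω : Set (Pt n)} {u v : Pt n → ℝ} (hu : Measurable u) :
    GG p α Ω (u - v) ≤ ENNReal.ofReal (2 ^ p) * (GG p α Ω u + GG p α Ω v) := by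
  unfold GG
  have := ps_kern_meas (n := n) p α
  rw [← lintegral_add_left (by fun_prop), ← lintegral_const_mul' _ _ ENNReal.ofReal_ne_top]
  refine lintegral_mono fun z => ?_
  have hk := ps_kern_nonneg p α z
  rw [← ENNReal.ofReal_add (by positivity) (by positivity), ← ENNReal.ofReal_mul (by positivity)]
  apply ENNReal.ofReal_le_ofReal
  have h1 := ps_add (a := u z.1 - u z.2) (b := v z.1 - v z.2) hp
  have e : (u - v) z.1 - (u - v) z.2 = (u z.1 - u z.2) - (v z.1 - v z.2) := by
    simp only [Pi.sub_apply]; ring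
  rw [e, ← add_mul, ← mul_assoc]
  gcongr

lemma ps_memW_sub {p α : ℝ} (hp : 2 ≤ p) {Ω : Set (Pt n)} {u v : Pt n → ℝ}
    (hu : memW p α Ω u) (hv : memW p α Ω v) : memW p α Ω (u - v) := by
  rw [ps_memW] at *
  refine ⟨hu.1.sub hv.1, (ps_AA_sub hp hu.1).trans_lt ?_, (ps_GG_sub hp hu.1).trans_lt ?_⟩
  · exact ENNReal.mul_lt_top ENNReal.ofReal_lt_top (ENNReal.add_lt_top.2 ⟨hu.2.1, hv.2.1⟩)
  · exact ENNReal.mul_lt_top ENNReal.ofReal_lt_top (ENNReal.add_lt_top.2 ⟨hu.2.2, hv.2.2⟩)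

lemma ps_jensen {X : Type*} [MeasurableSpace X] {μ : Measure X} {p : ℝ} (hp : 2 ≤ p)
    {f : X → ENNReal} (hf : AEMeasurable f μ) :
    (∫⁻ x, f x ∂μ) ^ p ≤ (μ univ) ^ (p - 1) * ∫⁻ x, f x ^ p ∂μ := by
  have hpq : p.HolderConjugate (Real.conjExponent p) :=
    Real.HolderConjugate.conjExponent (by linarith)
  have h := ENNReal.lintegral_mul_le_Lp_mul_Lq μ hpq hf (aemeasurable_const (b := (1 : ENNReal)))
  simp only [Pi.mul_apply, mul_one, ENNReal.one_rpow, lintegral_const, one_mul] at h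
  have hp0 : (0 : ℝ) ≤ p := by linarith
  refine (ENNReal.rpow_le_rpow h hp0).trans_eq ?_
  rw [ENNReal.mul_rpow_of_nonneg _ _ hp0, ← ENNReal.rpow_mul, ← ENNReal.rpow_mul]
  have e1 : 1 / p * p = 1 := by field_simp
  have e2 : 1 / Real.conjExponent p * p = p - 1 := by
    unfold Real.conjExponent
    have : p - 1 ≠ 0 := by linarith
    field_simp
  rw [e1, e2, ENNReal.rpow_one, mul_comm]

lemma ps_point {p : ℝ} (hp : 2 ≤ p) {w : Pt n → ℝ} (hw : Measurable w) {B : Set (Pt n)}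
    (hV0 : volume B ≠ 0) (hV : volume B ≠ ⊤) (hB : IntegrableOn w B) (x : Pt n) :
    ENNReal.ofReal (|w x| ^ p) ≤ 2 ^ (p - 1) *
      ((volume B)⁻¹ * (∫⁻ y in B, ENNReal.ofReal (|w x - w y| ^ p)) +
        ((volume B) ^ p)⁻¹ * ENNReal.ofReal (|∫ y in B, w y| ^ p)) := by
  have hp0 : (0 : ℝ) ≤ p := by linarith
  have e : ∀ a : ℝ, ENNReal.ofReal (|a| ^ p) = ‖a‖ₑ ^ p := by
    intro a
    rw [← ENNReal.ofReal_rpow_of_nonneg (abs_nonneg _) hp0, ← Real.norm_eq_abs, ofReal_norm]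
  simp only [e]
  have h1 : volume B * ‖w x‖ₑ ≤ (∫⁻ y in B, ‖w x - w y‖ₑ) + ‖∫ y in B, w y‖ₑ := by
    have hc : IntegrableOn (fun _ : Pt n => w x) B := by
      exact integrableOn_const hV
    have h2 : (volume B).toReal * w x = (∫ y in B, (w x - w y)) + ∫ y in B, w y := by
      rw [integral_sub hc hB]
      simp [Measure.real]
    calc volume B * ‖w x‖ₑ = ‖(volume B).toReal * w x‖ₑ := by
          rw [enorm_mul, Real.enorm_of_nonneg ENNReal.toReal_nonneg, ENNReal.ofReal_toReal hV]
      _ ≤ ‖∫ y in B, (w x - w y)‖ₑ + ‖∫ y in B, w y‖ₑ := by rw [h2]; exact enorm_add_le _ _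
      _ ≤ _ := by gcongr; exact enorm_integral_le_lintegral_enorm _
  have h3 : (volume B) ^ p * ‖w x‖ₑ ^ p ≤ 2 ^ (p - 1) *
      ((volume B) ^ (p - 1) * (∫⁻ y in B, ‖w x - w y‖ₑ ^ p) + ‖∫ y in B, w y‖ₑ ^ p) := by
    rw [← ENNReal.mul_rpow_of_nonneg _ _ hp0]
    refine (ENNReal.rpow_le_rpow h1 hp0).trans ?_
    refine (ENNReal.rpow_add_le_mul_rpow_add_rpow _ _ (by linarith)).trans ?_
    gcongr
    have := ps_jensen (μ := volume.restrict B) (f := fun y => ‖w x - w y‖ₑ) hp (by fun_prop)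
    simpa using this
  have hVp0 : (volume B) ^ p ≠ 0 := by
    intro h; rcases ENNReal.rpow_eq_zero_iff.1 h with h | h
    · exact hV0 h.1
    · exact hV h.1
  have hVp : (volume B) ^ p ≠ ⊤ := ENNReal.rpow_ne_top_of_nonneg hp0 hV
  calc ‖w x‖ₑ ^ p = ((volume B) ^ p)⁻¹ * ((volume B) ^ p * ‖w x‖ₑ ^ p) := by
        rw [← mul_assoc, ENNReal.inv_mul_cancel hVp0 hVp, one_mul]
    _ ≤ ((volume B) ^ p)⁻¹ * (2 ^ (p - 1) *
      ((volume B) ^ (p - 1) * (∫⁻ y in B, ‖w x - w y‖ₑ ^ p) + ‖∫ y in B, w y‖ₑ ^ p)) := by gcongr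
    _ = _ := by
      have e3 : ((volume B) ^ p)⁻¹ * (volume B) ^ (p - 1) = (volume B)⁻¹ := by
        rw [← ENNReal.rpow_neg, ← ENNReal.rpow_add _ _ hV0 hV, ← ENNReal.rpow_neg_one]
        congr 1; ring
      rw [← e3]; ring

lemma ps_kle {p α R : ℝ} (hp : 2 ≤ p) (hα : 0 < α) (w : Pt n → ℝ) {x y : Pt n}
    (h : ‖x - y‖ ≤ R) :
    |w x - w y| ^ p ≤ R ^ ((n : ℝ) + p * α) * (|w x - w y| ^ p * kern p α (x, y)) := by
  by_cases hxy : x = y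
  · subst hxy
    simp [Real.zero_rpow (by linarith : p ≠ 0)]
  · have h0 : 0 < ‖x - y‖ := norm_pos_iff.2 (sub_ne_zero.2 hxy)
    have hpα : 0 < p * α := by positivity
    have h1 : 1 ≤ R ^ ((n : ℝ) + p * α) * kern p α (x, y) := by
      unfold kern
      simp only
      rw [Real.rpow_neg h0.le, ← div_eq_mul_inv, one_le_div (by positivity)]
      exact Real.rpow_le_rpow h0.le h (by positivity)
    have h2 : 0 ≤ |w x - w y| ^ p := by positivity
    nlinarith

lemma ps_slice {p α : ℝ} {Ω : Set (Pt n)} {w : Pt n → ℝ} (hw : Measurable w) :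
    ∫⁻ x in Ω, ∫⁻ y, ENNReal.ofReal (|w x - w y| ^ p * kern p α (x, y)) ≤ GG p α Ω w := by
  have := ps_kern_meas (n := n) p α
  have hm : Measurable fun z : Pt n × Pt n =>
    ENNReal.ofReal (|w z.1 - w z.2| ^ p * kern p α z) := by fun_prop
  have e := lintegral_prod (μ := volume.restrict Ω) (ν := (volume : Measure (Pt n))) _
    hm.aemeasurable
  rw [← e]
  unfold GG
  apply lintegral_mono'
  · have : (volume.restrict Ω).prod (volume : Measure (Pt n))
        = (volume : Measure (Pt n × Pt n)).restrict (Ω ×ˢ univ) := by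
      rw [Measure.volume_eq_prod, ← Measure.prod_restrict, Measure.restrict_univ]
    rw [this]
    apply Measure.restrict_mono _ le_rfl
    rintro ⟨a, b⟩ h
    simp only [Qset, mem_compl_iff, mem_prod, mem_univ, and_true] at *
    tauto
  · exact le_rfl

lemma ps_local {p α R : ℝ} (hp : 2 ≤ p) (hα : 0 < α) {Ω B : Set (Pt n)}
    (hΩ : MeasurableSet Ω) (hB : MeasurableSet B) (hR0 : 0 ≤ R)
    (hR : ∀ x ∈ Ω, ∀ y ∈ B, ‖x - y‖ ≤ R) {w : Pt n → ℝ} (hw : Measurable w) :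
    volume Ω * (∫⁻ y in B, ENNReal.ofReal (|w y| ^ p)) ≤ ENNReal.ofReal (2 ^ p) *
      (volume B * AA p Ω w + ENNReal.ofReal (R ^ ((n : ℝ) + p * α)) * GG p α Ω w) := by
  have hk := ps_kern_meas (n := n) p α
  calc volume Ω * (∫⁻ y in B, ENNReal.ofReal (|w y| ^ p))
      = ∫⁻ x in Ω, ∫⁻ y in B, ENNReal.ofReal (|w y| ^ p) := by
        rw [lintegral_const, Measure.restrict_apply_univ, mul_comm]
    _ ≤ ∫⁻ x in Ω, (ENNReal.ofReal (2 ^ p) * (volume B * ENNReal.ofReal (|w x| ^ p) +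
        ENNReal.ofReal (R ^ ((n : ℝ) + p * α)) *
          ∫⁻ y, ENNReal.ofReal (|w x - w y| ^ p * kern p α (x, y)))) := by
        refine setLIntegral_mono' hΩ fun x hx => ?_
        calc ∫⁻ y in B, ENNReal.ofReal (|w y| ^ p) ≤
            ∫⁻ y in B, ENNReal.ofReal (2 ^ p) * (ENNReal.ofReal (|w x| ^ p) +
              ENNReal.ofReal (R ^ ((n : ℝ) + p * α)) *
                ENNReal.ofReal (|w x - w y| ^ p * kern p α (x, y))) := by
              refine setLIntegral_mono' hB fun y hy => ?_
              have hn := ps_kern_nonneg p α (x, y)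
              rw [← ENNReal.ofReal_mul (by positivity),
                ← ENNReal.ofReal_add (by positivity) (by positivity),
                ← ENNReal.ofReal_mul (by positivity)]
              apply ENNReal.ofReal_le_ofReal
              have h1 := ps_add (a := w x) (b := w x - w y) hp
              rw [sub_sub_cancel] at h1
              refine h1.trans ?_
              gcongr
              exact ps_kle hp hα w (hR x hx y hy)
          _ = ENNReal.ofReal (2 ^ p) * (volume B * ENNReal.ofReal (|w x| ^ p) +
              ENNReal.ofReal (R ^ ((n : ℝ) + p * α)) *
                ∫⁻ y in B, ENNReal.ofReal (|w x - w y| ^ p * kern p α (x, y))) := by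
              rw [lintegral_const_mul' _ _ ENNReal.ofReal_ne_top,
                lintegral_add_left measurable_const,
                lintegral_const_mul' _ _ ENNReal.ofReal_ne_top, lintegral_const,
                Measure.restrict_apply_univ, mul_comm (volume B)]
          _ ≤ _ := by
              gcongr
              exact Measure.restrict_le_self
    _ ≤ _ := by
        rw [lintegral_const_mul' _ _ ENNReal.ofReal_ne_top,
          lintegral_add_left (by fun_prop), lintegral_const_mul _ (by fun_prop),
          lintegral_const_mul' _ _ ENNReal.ofReal_ne_top]
        unfold AA
        gcongr
        exact ps_slice hw

/-- main estimate -/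
lemma ps_est {p α r : ℝ} (hp : 2 ≤ p) (hα : 0 < α) (hr : 0 < r) {Ω : Set (Pt n)}
    (hΩ : MeasurableSet Ω) {w : Pt n → ℝ} (hw : Measurable w)
    (hwi : ∀ c, IntegrableOn w (Metric.ball c r)) (e : ℕ → Pt n) (N : ℕ)
    (hcov : ∀ x ∈ Ω, ∃ i ≤ N, dist x (e i) < r) (b : ℝ)
    (hb : ∀ i ≤ N, |∫ y in Metric.ball (e i) r, w y| ^ p ≤ b) :
    AA p Ω w ≤ 2 ^ (p - 1) *
      ((volume (Metric.ball (0 : Pt n) r))⁻¹ * (ENNReal.ofReal ((2 * r) ^ ((n : ℝ) + p * α)) *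
        GG p α Ω w) +
        ((volume (Metric.ball (0 : Pt n) r)) ^ p)⁻¹ * (ENNReal.ofReal b * volume Ω)) := by
  set V := volume (Metric.ball (0 : Pt n) r) with hVdef
  have hV0 : V ≠ 0 := (Metric.measure_ball_pos _ _ hr).ne'
  have hV : V ≠ ⊤ := measure_ball_lt_top.ne
  have hk := ps_kern_meas (n := n) p α
  have h2 : (2 : ENNReal) ^ (p - 1) ≠ ⊤ :=
    ENNReal.rpow_ne_top_of_nonneg (by linarith) (by norm_num)
  calc AA p Ω w ≤ ∫⁻ x in Ω, 2 ^ (p - 1) *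
      (V⁻¹ * (ENNReal.ofReal ((2 * r) ^ ((n : ℝ) + p * α)) *
        (∫⁻ y, ENNReal.ofReal (|w x - w y| ^ p * kern p α (x, y)))) +
        (V ^ p)⁻¹ * ENNReal.ofReal b) := by
        refine setLIntegral_mono' hΩ fun x hx => ?_
        obtain ⟨i, hi, hd⟩ := hcov x hx
        have hVi : volume (Metric.ball (e i) r) = V := Measure.addHaar_ball_center _ _ _
        have h := ps_point hp hw (B := Metric.ball (e i) r) (by rwa [hVi]) (by rwa [hVi])
          (hwi _) x
        rw [hVi] at h
        refine h.trans ?_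
        gcongr
        · rw [← lintegral_const_mul' _ _ ENNReal.ofReal_ne_top]
          refine (setLIntegral_mono' Metric.isOpen_ball.measurableSet fun y hy => ?_).trans
            (lintegral_mono' Measure.restrict_le_self le_rfl)
          rw [← ENNReal.ofReal_mul (by positivity)]
          apply ENNReal.ofReal_le_ofReal
          apply ps_kle hp hα w
          rw [← dist_eq_norm]
          have h3 := dist_triangle_right x y (e i)
          rw [Metric.mem_ball] at hy
          linarith
        · exact hb i hi
    _ ≤ _ := by
        rw [lintegral_const_mul' _ _ h2, lintegral_add_right _ measurable_const,
          lintegral_const_mul' _ _ (ENNReal.inv_ne_top.2 hV0),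
          lintegral_const_mul' _ _ ENNReal.ofReal_ne_top, lintegral_const,
          Measure.restrict_apply_univ, mul_assoc]
        gcongr
        exact ps_slice hw

lemma ps_cm {p α : ℝ} (hp : 2 ≤ p) (hα : 0 < α) :
    Tendsto (fun m : ℕ => (volume (Metric.ball (0 : Pt n) (1 / ((m : ℝ) + 1))))⁻¹ *
      ENNReal.ofReal ((2 * (1 / ((m : ℝ) + 1))) ^ ((n : ℝ) + p * α))) atTop (𝓝 0) := by
  have hpα : 0 < p * α := by positivity
  set V1 := volume (Metric.ball (0 : Pt n) 1)
  have hV0 : V1 ≠ 0 := (Metric.measure_ball_pos _ _ one_pos).ne'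
  have e : ∀ r : ℝ, 0 < r → (volume (Metric.ball (0 : Pt n) r))⁻¹ *
      ENNReal.ofReal ((2 * r) ^ ((n : ℝ) + p * α)) =
      V1⁻¹ * ENNReal.ofReal (2 ^ ((n : ℝ) + p * α) * r ^ (p * α)) := by
    intro r hr
    have hrn : 0 < r ^ n := by positivity
    rw [Measure.addHaar_ball_of_pos _ _ hr, finrank_euclideanSpace_fin,
      ENNReal.mul_inv (Or.inr measure_ball_lt_top.ne) (Or.inr hV0),
      ← ENNReal.ofReal_inv_of_pos hrn, mul_comm (ENNReal.ofReal _), mul_assoc,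
      ← ENNReal.ofReal_mul (by positivity)]
    congr 2
    rw [Real.mul_rpow (by norm_num) hr.le, Real.rpow_add hr, Real.rpow_natCast]
    field_simp
  have e2 : ∀ m : ℕ, (0 : ℝ) < 1 / ((m : ℝ) + 1) := fun m => Nat.one_div_pos_of_nat
  simp_rw [fun m : ℕ => e _ (e2 m)]
  have h1 : Tendsto (fun m : ℕ => (2 : ℝ) ^ ((n : ℝ) + p * α) * (1 / ((m : ℝ) + 1)) ^ (p * α))
      atTop (𝓝 (2 ^ ((n : ℝ) + p * α) * 0 ^ (p * α))) :=
    ((tendsto_one_div_add_atTop_nhds_zero_nat (𝕜 := ℝ)).rpow_const (Or.inr hpα.le)).const_mul _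
  rw [Real.zero_rpow hpα.ne', mul_zero] at h1
  have h2 := ENNReal.tendsto_ofReal h1
  have h3 := ENNReal.Tendsto.const_mul (a := V1⁻¹) h2 (Or.inr (ENNReal.inv_ne_top.2 hV0))
  simpa using h3

lemma ps_compact {p α : ℝ} (hp : 2 ≤ p) (hα : 0 < α) {Ω : Set (Pt n)}
    (hΩo : IsOpen Ω) (hΩne : Ω.Nonempty) (hΩb : Bornology.IsBounded Ω) (u : ℕ → Pt n → ℝ)
    (hu : ∀ k, Measurable (u k)) (M : ENNReal) (hM : M ≠ ⊤) (hA : ∀ k, AA p Ω (u k) ≤ M)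
    (hG : ∀ k, GG p α Ω (u k) ≤ M) :
    ∃ ψ : ℕ → ℕ, StrictMono ψ ∧ ∀ δ : ENNReal, 0 < δ → ∃ N, ∀ k ≥ N, ∀ l ≥ N,
      AA p Ω (u (ψ k) - u (ψ l)) ≤ δ := by
  have hp0 : (0 : ℝ) < p := by linarith
  have hvΩ0 : volume Ω ≠ 0 := (hΩo.measure_pos _ hΩne).ne'
  have hvΩ : volume Ω ≠ ⊤ := hΩb.measure_lt_top.ne
  have hloc : ∀ (c : Pt n) (r : ℝ), ∃ C : ENNReal, C ≠ ⊤ ∧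
      ∀ k, ∫⁻ y in Metric.ball c r, ‖u k y‖ₑ ≤ C := by
    intro c r
    obtain ⟨R, hR⟩ := (hΩb.union (Metric.isBounded_ball (x := c) (r := r))).exists_norm_le
    have hR' : ∀ x ∈ Ω, ∀ y ∈ Metric.ball c r, ‖x - y‖ ≤ max (2 * R) 0 := by
      intro x hx y hy
      have h1 := hR x (Or.inl hx)
      have h2 := hR y (Or.inr hy)
      have := norm_sub_le x y
      exact le_max_of_le_left (by linarith)
    set B := Metric.ball c r
    have hB : volume B ≠ ⊤ := measure_ball_lt_top.ne
    set C0 := ENNReal.ofReal (2 ^ p) *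
      (volume B * M + ENNReal.ofReal ((max (2 * R) 0) ^ ((n : ℝ) + p * α)) * M)
    have hC0 : C0 ≠ ⊤ := ENNReal.mul_ne_top ENNReal.ofReal_ne_top
      (ENNReal.add_ne_top.2 ⟨ENNReal.mul_ne_top hB hM, ENNReal.mul_ne_top ENNReal.ofReal_ne_top hM⟩)
    refine ⟨volume B + (volume Ω)⁻¹ * C0, ENNReal.add_ne_top.2
      ⟨hB, ENNReal.mul_ne_top (ENNReal.inv_ne_top.2 hvΩ0) hC0⟩, fun k => ?_⟩
    have h1 : volume Ω * (∫⁻ y in B, ENNReal.ofReal (|u k y| ^ p)) ≤ C0 := by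
      refine (ps_local hp hα hΩo.measurableSet Metric.isOpen_ball.measurableSet
        (le_max_right _ _) hR' (hu k)).trans ?_
      have h3 := hA k
      have h4 := hG k
      change _ ≤ ENNReal.ofReal (2 ^ p) *
        (volume B * M + ENNReal.ofReal ((max (2 * R) 0) ^ ((n : ℝ) + p * α)) * M)
      gcongr
    have h2 : ∫⁻ y in B, ENNReal.ofReal (|u k y| ^ p) ≤ (volume Ω)⁻¹ * C0 := by
      calc _ = (volume Ω)⁻¹ * (volume Ω * (∫⁻ y in B, ENNReal.ofReal (|u k y| ^ p))) := by
            rw [← mul_assoc, ENNReal.inv_mul_cancel hvΩ0 hvΩ, one_mul]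
        _ ≤ _ := by gcongr
    calc ∫⁻ y in B, ‖u k y‖ₑ ≤ ∫⁻ y in B, (1 + ENNReal.ofReal (|u k y| ^ p)) := by
          refine lintegral_mono fun y => ?_
          rw [← ofReal_norm, Real.norm_eq_abs, ← ENNReal.ofReal_one,
            ← ENNReal.ofReal_add (by norm_num) (by positivity)]
          apply ENNReal.ofReal_le_ofReal
          have h0 : 0 ≤ |u k y| ^ p := by positivity
          rcases le_total |u k y| 1 with h | h
          · linarith
          · have := Real.self_le_rpow_of_one_le h (by linarith : 1 ≤ p)
            linarith
      _ = volume B + ∫⁻ y in B, ENNReal.ofReal (|u k y| ^ p) := by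
          rw [lintegral_add_left measurable_const, lintegral_const,
            Measure.restrict_apply_univ, one_mul]
      _ ≤ _ := by gcongr
  have hinteg : ∀ k (c : Pt n) (r : ℝ), IntegrableOn (u k) (Metric.ball c r) := by
    intro k c r
    obtain ⟨C, hC, h⟩ := hloc c r
    exact ⟨(hu k).aestronglyMeasurable, (h k).trans_lt hC.lt_top⟩
  let e : ℕ → Pt n := TopologicalSpace.denseSeq (Pt n)
  let a : ℕ → (ℕ × ℕ → ℝ) := fun k mi => ∫ y in Metric.ball (e mi.2) (1 / ((mi.1 : ℝ) + 1)), u k y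
  choose C hC hCle using hloc
  have hmem : ∀ k, a k ∈ Set.pi univ (fun mi : ℕ × ℕ =>
      Icc (-(C (e mi.2) (1 / ((mi.1 : ℝ) + 1))).toReal) (C (e mi.2) (1 / ((mi.1 : ℝ) + 1))).toReal) := by
    intro k mi _
    rw [mem_Icc, ← abs_le, ← Real.norm_eq_abs, ← toReal_enorm]
    exact ENNReal.toReal_mono (hC _ _)
      ((enorm_integral_le_lintegral_enorm _).trans (hCle _ _ k))
  obtain ⟨L, -, ψ, hψ, hL⟩ := (isCompact_univ_pi fun _ => isCompact_Icc).tendsto_subseq hmem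
  refine ⟨ψ, hψ, fun δ hδ => ?_⟩
  set D := ENNReal.ofReal (2 ^ p) * (M + M)
  have hD : D ≠ ⊤ := ENNReal.mul_ne_top ENNReal.ofReal_ne_top (ENNReal.add_ne_top.2 ⟨hM, hM⟩)
  have h2 : (2 : ENNReal) ^ (p - 1) ≠ ⊤ :=
    ENNReal.rpow_ne_top_of_nonneg (by linarith) (by norm_num)
  have hδ2 : (0 : ENNReal) < δ / 2 := ENNReal.half_pos hδ.ne'
  obtain ⟨m, hm⟩ : ∃ m : ℕ, 2 ^ (p - 1) * D *
      ((volume (Metric.ball (0 : Pt n) (1 / ((m : ℝ) + 1))))⁻¹ *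
      ENNReal.ofReal ((2 * (1 / ((m : ℝ) + 1))) ^ ((n : ℝ) + p * α))) < δ / 2 := by
    have h3 := ENNReal.Tendsto.const_mul (a := 2 ^ (p - 1) * D) (ps_cm (n := n) hp hα)
      (Or.inr (ENNReal.mul_ne_top h2 hD))
    rw [mul_zero] at h3
    exact (h3.eventually_lt_const hδ2).exists
  set r : ℝ := 1 / ((m : ℝ) + 1) with hrdef
  have hr : 0 < r := Nat.one_div_pos_of_nat
  set V := volume (Metric.ball (0 : Pt n) r)
  have hV0 : V ≠ 0 := (Metric.measure_ball_pos _ _ hr).ne'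
  have hVp0 : V ^ p ≠ 0 := by
    intro h; rcases ENNReal.rpow_eq_zero_iff.1 h with h | h
    · exact hV0 h.1
    · linarith
  obtain ⟨b, hb0, hb⟩ := ENNReal.exists_nnreal_pos_mul_lt
    (a := 2 ^ (p - 1) * ((V ^ p)⁻¹ * volume Ω)) (b := δ / 2)
    (ENNReal.mul_ne_top h2 (ENNReal.mul_ne_top (ENNReal.inv_ne_top.2 hVp0) hvΩ)) hδ2.ne'
  obtain ⟨N0, hN0⟩ : ∃ N0, ∀ x ∈ Ω, ∃ i ≤ N0, dist x (e i) < r := by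
    obtain ⟨t, ht⟩ := hΩb.isCompact_closure.elim_finite_subcover (fun i => Metric.ball (e i) r)
      (fun i => Metric.isOpen_ball) (by
        intro x _
        obtain ⟨i, hi⟩ := (TopologicalSpace.denseRange_denseSeq (Pt n)).exists_dist_lt x hr
        exact mem_iUnion.2 ⟨i, hi⟩)
    refine ⟨t.sup id, fun x hx => ?_⟩
    obtain ⟨i, hi, hx'⟩ := mem_iUnion₂.1 (ht (subset_closure hx))
    exact ⟨i, Finset.le_sup (f := id) hi, hx'⟩
  have hd : (0 : ℝ) < (b : ℝ) ^ (1 / p) / 2 := by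
    have : (0 : ℝ) < b := hb0
    positivity
  have hev : ∀ᶠ k in atTop, ∀ i ∈ Set.Iic N0, |a (ψ k) (m, i) - L (m, i)| < (b : ℝ) ^ (1 / p) / 2 := by
    rw [Filter.eventually_all_finite (Set.finite_Iic N0)]
    intro i _
    have := (tendsto_pi_nhds.1 hL (m, i)).eventually (Metric.ball_mem_nhds _ hd)
    filter_upwards [this] with k hk
    simpa [Real.dist_eq] using hk
  obtain ⟨N, hN⟩ := eventually_atTop.1 hev
  refine ⟨N, fun k hk l hl => ?_⟩
  have hest := ps_est hp hα hr hΩo.measurableSet ((hu (ψ k)).sub (hu (ψ l)))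
    (fun c => (hinteg _ _ _).sub (hinteg _ _ _)) e N0 hN0 b (by
      intro i hi
      have h1 := hN k hk i hi
      have h3 := hN l hl i hi
      have e1 : ∫ y in Metric.ball (e i) r, (u (ψ k) - u (ψ l)) y =
          a (ψ k) (m, i) - a (ψ l) (m, i) := by
        simp only [Pi.sub_apply]
        rw [integral_sub (hinteg _ _ _) (hinteg _ _ _)]
      rw [e1]
      have h4 : |a (ψ k) (m, i) - a (ψ l) (m, i)| ≤ (b : ℝ) ^ (1 / p) := by
        rw [abs_lt] at h1 h3
        rw [abs_le]
        constructor <;> linarith [h1.1, h1.2, h3.1, h3.2]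
      calc |a (ψ k) (m, i) - a (ψ l) (m, i)| ^ p ≤ ((b : ℝ) ^ (1 / p)) ^ p :=
            Real.rpow_le_rpow (abs_nonneg _) h4 hp0.le
        _ = b := by
            rw [← Real.rpow_mul b.coe_nonneg, one_div_mul_cancel hp0.ne', Real.rpow_one])
  refine hest.trans ?_
  have hGD : GG p α Ω (u (ψ k) - u (ψ l)) ≤ D := by
    refine (ps_GG_sub hp (hu _)).trans ?_
    have h3 := hG (ψ k)
    have h4 := hG (ψ l)
    change _ ≤ ENNReal.ofReal (2 ^ p) * (M + M)
    gcongr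
  calc _ ≤ 2 ^ (p - 1) *
      (V⁻¹ * (ENNReal.ofReal ((2 * r) ^ ((n : ℝ) + p * α)) * D) +
        (V ^ p)⁻¹ * (ENNReal.ofReal b * volume Ω)) := by gcongr
    _ = 2 ^ (p - 1) * D * (V⁻¹ * ENNReal.ofReal ((2 * r) ^ ((n : ℝ) + p * α))) +
        b * (2 ^ (p - 1) * ((V ^ p)⁻¹ * volume Ω)) := by
        rw [ENNReal.ofReal_coe_nnreal]; ring
    _ ≤ δ / 2 + δ / 2 := add_le_add hm.le hb.le
    _ = δ := ENNReal.add_halves δ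

lemma ps_fatou {X : Type*} [MeasurableSpace X] {μ : Measure X} {f : ℕ → X → ENNReal}
    {g : X → ENNReal} (hf : ∀ j, Measurable (f j))
    (h : ∀ᵐ x ∂μ, Tendsto (fun j => f j x) atTop (𝓝 (g x))) {δ : ENNReal}
    (hδ : ∀ᶠ j in atTop, ∫⁻ x, f j x ∂μ ≤ δ) : ∫⁻ x, g x ∂μ ≤ δ := by
  calc ∫⁻ x, g x ∂μ = ∫⁻ x, liminf (fun j => f j x) atTop ∂μ := by
        refine lintegral_congr_ae ?_
        filter_upwards [h] with x hx
        exact hx.liminf_eq.symm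
    _ ≤ liminf (fun j => ∫⁻ x, f j x ∂μ) atTop := lintegral_liminf_le hf
    _ ≤ δ := liminf_le_of_frequently_le' hδ.frequently

lemma ps_normW {p α : ℝ} {Ω : Set (Pt n)} {u : Pt n → ℝ} (hu : Measurable u) :
    normW p α Ω u = ((AA p Ω u).toReal + (GG p α Ω u).toReal) ^ (1 / p) := by
  unfold normW
  rw [ps_lpP hu, ps_gagP hu]

lemma ps_complete {p α : ℝ} (hp : 2 ≤ p) {Ω : Set (Pt n)}
    (hΩo : IsOpen Ω) (hΩne : Ω.Nonempty) (v : ℕ → Pt n → ℝ) (hv : ∀ k, memW p α Ω (v k))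
    (hc : ∀ δ : ENNReal, 0 < δ → ∃ N, ∀ k ≥ N, ∀ l ≥ N,
      AA p Ω (v k - v l) ≤ δ ∧ GG p α Ω (v k - v l) ≤ δ) :
    ∃ w, memW p α Ω w ∧ Tendsto (fun k => normW p α Ω (v k - w)) atTop (𝓝 0) := by
  have hp0 : (0 : ℝ) < p := by linarith
  have hm : ∀ k, Measurable (v k) := fun k => (hv k).1
  have hk := ps_kern_meas (n := n) p α
  have hΩ0 : volume Ω ≠ 0 := (hΩo.measure_pos _ hΩne).ne'
  have e : ∀ a : ℝ, ENNReal.ofReal (|a| ^ p) = ‖a‖ₑ ^ p := by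
    intro a
    rw [← ENNReal.ofReal_rpow_of_nonneg (abs_nonneg _) hp0.le, ← Real.norm_eq_abs, ofReal_norm]
  let b : ℕ → ENNReal := fun N => (2⁻¹ : ENNReal) ^ (N + 1)
  have hb0 : ∀ N, 0 < b N := fun N => ENNReal.pow_pos (by simp) _
  have hbt : ∀ N, b N ≠ ⊤ := fun N => ENNReal.pow_ne_top (by simp)
  have hbp : ∀ N, 0 < (b N) ^ p := fun N => ENNReal.rpow_pos (hb0 N) (hbt N)
  obtain ⟨φ, hφ, hP⟩ := Filter.extraction_forall_of_eventually
    (P := fun N K => ∀ k ≥ K, ∀ l ≥ K,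
      AA p Ω (v k - v l) ≤ (b N) ^ p ∧ GG p α Ω (v k - v l) ≤ (b N) ^ p) (by
      intro N
      obtain ⟨K, hK⟩ := hc _ (hbp N)
      filter_upwards [eventually_ge_atTop K] with K' hK' k hk l hl
      exact hK k (by omega) l (by omega))
  let B : ℕ → ENNReal := fun N => (2⁻¹ : ENNReal) ^ N
  have hB : ∑' i, B i ≠ ⊤ := by
    simp only [B, ENNReal.tsum_geometric]
    simp
  have hbB : ∀ N (X : ENNReal), X ≤ (b N) ^ p → X ^ (1 / p) < B N := by
    intro N X hX
    calc X ^ (1 / p) ≤ ((b N) ^ p) ^ (1 / p) := ENNReal.rpow_le_rpow hX (by positivity)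
      _ = b N := by rw [← ENNReal.rpow_mul, mul_one_div_cancel hp0.ne', ENNReal.rpow_one]
      _ < B N := by
        simp only [b, B]
        rw [pow_succ, ← div_eq_mul_inv]
        exact ENNReal.half_lt_self (pow_ne_zero _ (by simp)) (ENNReal.pow_ne_top (by simp))
  have h1 : ∀ᵐ x ∂(volume.restrict Ω), ∃ l, Tendsto (fun j => v (φ j) x) atTop (𝓝 l) := by
    refine Lp.ae_tendsto_of_cauchy_eLpNorm' (f := fun j => v (φ j)) (p := p)
      (fun j => (hm _).aestronglyMeasurable) (by linarith) hB ?_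
    intro N k l hNk hNl
    have := hP N (φ k) (hφ.monotone hNk) (φ l) (hφ.monotone hNl)
    refine hbB N _ ?_
    have h := this.1
    unfold AA at h
    simpa only [e] using h
  have h2 : ∀ᵐ z ∂(volume.restrict (Qset Ω)),
      ∃ l, Tendsto (fun j => v (φ j) z.1 - v (φ j) z.2) atTop (𝓝 l) := by
    have hkm : Measurable fun z : Pt n × Pt n => ENNReal.ofReal (kern p α z) := by fun_prop
    have h3 : ∀ᵐ z ∂((volume.restrict (Qset Ω)).withDensity
        fun z => ENNReal.ofReal (kern p α z)),
        ∃ l, Tendsto (fun j => v (φ j) z.1 - v (φ j) z.2) atTop (𝓝 l) := by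
      refine Lp.ae_tendsto_of_cauchy_eLpNorm'
        (f := fun j (z : Pt n × Pt n) => v (φ j) z.1 - v (φ j) z.2) (p := p)
        (fun j => Measurable.aestronglyMeasurable (by have := hm (φ j); fun_prop))
        (by linarith) hB ?_
      intro N k l hNk hNl
      have := hP N (φ k) (hφ.monotone hNk) (φ l) (hφ.monotone hNl)
      refine hbB N _ ?_
      have h := this.2
      unfold GG at h
      have hmk := hm (φ k)
      have hml := hm (φ l)
      rw [lintegral_withDensity_eq_lintegral_mul _ hkm (by fun_prop)]
      refine le_trans (le_of_eq ?_) h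
      refine lintegral_congr fun z => ?_
      rw [ENNReal.ofReal_mul (by positivity), e, mul_comm]
      simp only [Pi.mul_apply, Pi.sub_apply]
      congr 3
      ring
    rw [ae_withDensity_iff hkm] at h3
    filter_upwards [h3] with z hz
    by_cases h0 : z.1 = z.2
    · exact ⟨0, by simp [h0]⟩
    · apply hz
      have : 0 < ‖z.1 - z.2‖ := norm_pos_iff.2 (sub_ne_zero.2 h0)
      have : 0 < kern p α z := by unfold kern; positivity
      simpa using this
  have h2' : ∀ᵐ x ∂(volume.restrict Ω), ∀ᵐ y ∂(volume : Measure (Pt n)),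
      ∃ l, Tendsto (fun j => v (φ j) x - v (φ j) y) atTop (𝓝 l) := by
    have h4 : ∀ᵐ z ∂((volume.restrict Ω).prod (volume : Measure (Pt n))),
        ∃ l, Tendsto (fun j => v (φ j) z.1 - v (φ j) z.2) atTop (𝓝 l) := by
      have : (volume.restrict Ω).prod (volume : Measure (Pt n))
          = (volume : Measure (Pt n × Pt n)).restrict (Ω ×ˢ univ) := by
        rw [Measure.volume_eq_prod, ← Measure.prod_restrict, Measure.restrict_univ]
      rw [this]
      refine ae_restrict_of_ae_restrict_of_subset ?_ h2
      rintro ⟨a, b⟩ h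
      simp only [Qset, mem_compl_iff, mem_prod, mem_univ, and_true] at *
      tauto
    exact Measure.ae_ae_of_ae_prod h4
  have hne : (ae (volume.restrict Ω)).NeBot := by
    rw [ae_neBot]
    intro h
    exact hΩ0 (by rwa [Measure.restrict_eq_zero] at h)
  obtain ⟨x0, ⟨l0, hl0⟩, hx0⟩ := (h1.and h2').exists
  have h3 : ∀ᵐ y ∂(volume : Measure (Pt n)), ∃ l, Tendsto (fun j => v (φ j) y) atTop (𝓝 l) := by
    filter_upwards [hx0] with y hy
    obtain ⟨l, hl⟩ := hy
    refine ⟨l0 - l, ?_⟩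
    simpa using hl0.sub hl
  obtain ⟨w, hw, hlim⟩ := measurable_limit_of_tendsto_metrizable_ae
    (fun j => (hm (φ j)).aemeasurable) h3
  have hfat : ∀ δ : ENNReal, 0 < δ → ∃ N, ∀ k ≥ N,
      AA p Ω (v k - w) ≤ δ ∧ GG p α Ω (v k - w) ≤ δ := by
    intro δ hδ
    obtain ⟨N, hN⟩ := hc δ hδ
    refine ⟨N, fun k hkN => ⟨?_, ?_⟩⟩
    · refine ps_fatou (f := fun j x => ENNReal.ofReal (|(v k - v (φ j)) x| ^ p)) ?_ ?_ ?_
      · intro j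
        have := hm k
        have := hm (φ j)
        fun_prop
      · filter_upwards [ae_restrict_of_ae hlim] with x hx
        refine ENNReal.tendsto_ofReal (Tendsto.rpow_const ?_ (Or.inr hp0.le))
        exact (hx.const_sub (v k x)).abs
      · filter_upwards [eventually_ge_atTop N] with j hj
        exact (hN k hkN (φ j) (hj.trans (hφ.id_le j))).1
    · refine ps_fatou (f := fun j (z : Pt n × Pt n) => ENNReal.ofReal
        (|(v k - v (φ j)) z.1 - (v k - v (φ j)) z.2| ^ p * kern p α z)) ?_ ?_ ?_
      · intro j
        have := hm k
        have := hm (φ j)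
        fun_prop
      · have ha : ∀ᵐ z ∂(volume : Measure (Pt n × Pt n)),
            Tendsto (fun j => v (φ j) z.1) atTop (𝓝 (w z.1)) :=
          Measure.quasiMeasurePreserving_fst.ae hlim
        have hb : ∀ᵐ z ∂(volume : Measure (Pt n × Pt n)),
            Tendsto (fun j => v (φ j) z.2) atTop (𝓝 (w z.2)) :=
          Measure.quasiMeasurePreserving_snd.ae hlim
        filter_upwards [ae_restrict_of_ae ha, ae_restrict_of_ae hb] with z hz1 hz2
        refine ENNReal.tendsto_ofReal (Tendsto.mul_const _
          (Tendsto.rpow_const ?_ (Or.inr hp0.le)))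
        exact ((hz1.const_sub (v k z.1)).sub (hz2.const_sub (v k z.2))).abs
      · filter_upwards [eventually_ge_atTop N] with j hj
        exact (hN k hkN (φ j) (hj.trans (hφ.id_le j))).2
  refine ⟨w, ?_, ?_⟩
  · obtain ⟨N, hN⟩ := hfat 1 one_pos
    have hd : memW p α Ω (v N - w) := by
      rw [ps_memW]
      exact ⟨(hm N).sub hw, (hN N le_rfl).1.trans_lt ENNReal.one_lt_top,
        (hN N le_rfl).2.trans_lt ENNReal.one_lt_top⟩
    have := ps_memW_sub hp (hv N) hd
    rwa [sub_sub_cancel] at this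
  · have hA : Tendsto (fun k => AA p Ω (v k - w)) atTop (𝓝 0) :=
      ENNReal.tendsto_atTop_zero.2 fun δ hδ => by
        obtain ⟨N, hN⟩ := hfat δ hδ
        exact ⟨N, fun k hk => (hN k hk).1⟩
    have hG : Tendsto (fun k => GG p α Ω (v k - w)) atTop (𝓝 0) :=
      ENNReal.tendsto_atTop_zero.2 fun δ hδ => by
        obtain ⟨N, hN⟩ := hfat δ hδ
        exact ⟨N, fun k hk => (hN k hk).2⟩
    have hA' := (ENNReal.tendsto_toReal ENNReal.zero_ne_top).comp hA
    have hG' := (ENNReal.tendsto_toReal ENNReal.zero_ne_top).comp hG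
    have := (hA'.add hG').rpow_const (p := 1 / p) (Or.inr (by positivity))
    simp only [ENNReal.toReal_zero, add_zero] at this
    rw [Real.zero_rpow (by positivity)] at this
    refine this.congr fun k => ?_
    rw [ps_normW ((hm k).sub hw)]
    rfl

lemma ps_gbound {p α d : ℝ} (hp : 2 ≤ p) (hd : 0 < d) {Ω D : Set (Pt n)}
    (hDΩ : D ⊆ Ω) {u v g : Pt n → ℝ} (hu : memW p α Ω u) (hv : memW p α Ω v)
    (hg : ∀ x, |g x| ≤ |u x| ^ (p - 1)) :
    |∫ x in D, g x * v x| ≤ d * lpP p Ω u + d ^ (1 - p) * lpP p Ω v := by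
  have hi : Integrable (fun x => d * |u x| ^ p + d ^ (1 - p) * |v x| ^ p) (volume.restrict Ω) :=
    ((ps_intA hu).const_mul _).add ((ps_intA hv).const_mul _)
  have h1 : |∫ x in D, g x * v x| ≤ ∫ x in D, (d * |u x| ^ p + d ^ (1 - p) * |v x| ^ p) := by
    rw [← Real.norm_eq_abs]
    refine norm_integral_le_of_norm_le (hi.mono_measure (Measure.restrict_mono hDΩ le_rfl)) ?_
    refine Filter.Eventually.of_forall fun x => ?_
    rw [Real.norm_eq_abs, abs_mul]
    refine le_trans ?_ (ps_young hp hd)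
    gcongr
    exact hg x
  refine h1.trans ?_
  have h2 : ∫ x in D, (d * |u x| ^ p + d ^ (1 - p) * |v x| ^ p) ≤
      ∫ x in Ω, (d * |u x| ^ p + d ^ (1 - p) * |v x| ^ p) := by
    refine setIntegral_mono_set hi ?_ (LE.le.eventuallyLE hDΩ)
    exact Filter.Eventually.of_forall fun x => by positivity
  refine h2.trans_eq ?_
  rw [integral_add ((ps_intA hu).const_mul _) ((ps_intA hv).const_mul _),
    integral_const_mul, integral_const_mul]
  rfl

lemma ps_intH {p α : ℝ} (hp : 2 ≤ p) {Ω : Set (Pt n)} {u v : Pt n → ℝ}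
    (hu : memW p α Ω u) (hv : memW p α Ω v) :
    Integrable (fun z : Pt n × Pt n =>
      |u z.1 - u z.2| ^ (p - 2) * (u z.1 - u z.2) * (v z.1 - v z.2) * kern p α z)
      (volume.restrict (Qset Ω)) := by
  have hk := ps_kern_meas (n := n) p α
  have h1 := hu.1
  have h2 := hv.1
  refine ((ps_intG hu).add (ps_intG hv)).mono' (Measurable.aestronglyMeasurable (by fun_prop)) ?_
  refine Filter.Eventually.of_forall fun z => ?_
  have hn := ps_kern_nonneg p α z
  rw [Real.norm_eq_abs, abs_mul, abs_mul, ps_absg hp, abs_of_nonneg hn]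
  have := ps_young (a := u z.1 - u z.2) (b := v z.1 - v z.2) (d := 1) hp one_pos
  rw [Real.one_rpow, one_mul, one_mul] at this
  simp only [Pi.add_apply]
  rw [← add_mul]
  gcongr

lemma ps_Hmono {p α : ℝ} (hp : 2 ≤ p) {Ω : Set (Pt n)} {u w : Pt n → ℝ}
    (hu : memW p α Ω u) (hw : memW p α Ω w) :
    2 ^ (1 - p) * gagP p α Ω (u - w) ≤
      Hform p α Ω u (u - w) - Hform p α Ω w (u - w) := by
  have hv := ps_memW_sub hp hu hw
  unfold Hform gagP
  rw [← integral_sub (ps_intH hp hu hv) (ps_intH hp hw hv), ← integral_const_mul]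
  refine integral_mono ((ps_intG hv).const_mul _)
    ((ps_intH hp hu hv).sub (ps_intH hp hw hv)) fun z => ?_
  have hn := ps_kern_nonneg p α z
  have h := ps_mono (a := u z.1 - u z.2) (b := w z.1 - w z.2) hp
  have e : (u - w) z.1 - (u - w) z.2 = (u z.1 - u z.2) - (w z.1 - w z.2) := by
    simp only [Pi.sub_apply]; ring
  simp only [e]
  have := mul_le_mul_of_nonneg_right h hn
  nlinarith

lemma ps_Lam_pos (hn : 1 ≤ n) {p : ℝ} (hp : 2 ≤ p) : 0 < Lam n p := by
  unfold Lam
  have h1 : 0 < Real.Gamma (((n : ℝ) + p) / 2) := Real.Gamma_pos_of_pos (by positivity)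
  have h2 : 0 < Real.Gamma ((p + 1) / 2) := Real.Gamma_pos_of_pos (by positivity)
  have := Real.pi_pos
  positivity

lemma ps_lpP_sub {p α : ℝ} (hp : 2 ≤ p) {Ω : Set (Pt n)} {u v : Pt n → ℝ}
    (hu : memW p α Ω u) (hv : memW p α Ω v) :
    lpP p Ω (u - v) ≤ 2 ^ p * (lpP p Ω u + lpP p Ω v) := by
  have h1 := ps_memW.1 hu
  have h2 := ps_memW.1 hv
  rw [ps_lpP h1.1, ps_lpP h2.1, ps_lpP (h1.1.sub h2.1),
    ← ENNReal.toReal_add h1.2.1.ne h2.2.1.ne,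
    ← ENNReal.toReal_ofReal (by positivity : (0 : ℝ) ≤ 2 ^ p), ← ENNReal.toReal_mul]
  exact ENNReal.toReal_mono (ENNReal.mul_ne_top ENNReal.ofReal_ne_top
    (ENNReal.add_ne_top.2 ⟨h1.2.1.ne, h2.2.1.ne⟩)) (ps_AA_sub hp h1.1)

lemma ps_gagP_sub {p α : ℝ} (hp : 2 ≤ p) {Ω : Set (Pt n)} {u v : Pt n → ℝ}
    (hu : memW p α Ω u) (hv : memW p α Ω v) :
    gagP p α Ω (u - v) ≤ 2 ^ p * (gagP p α Ω u + gagP p α Ω v) := by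
  have h1 := ps_memW.1 hu
  have h2 := ps_memW.1 hv
  rw [ps_gagP h1.1, ps_gagP h2.1, ps_gagP (h1.1.sub h2.1),
    ← ENNReal.toReal_add h1.2.2.ne h2.2.2.ne,
    ← ENNReal.toReal_ofReal (by positivity : (0 : ℝ) ≤ 2 ^ p), ← ENNReal.toReal_mul]
  exact ENNReal.toReal_mono (ENNReal.mul_ne_top ENNReal.ofReal_ne_top
    (ENNReal.add_ne_top.2 ⟨h1.2.2.ne, h2.2.2.ne⟩)) (ps_GG_sub hp h1.1)

/-- `J_s` satisfies the Palais–Smale condition on `S`. -/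
theorem stmt_3 (n : ℕ) (p α ε : ℝ) (Ω : Set (Pt n))
    (hn : 1 ≤ n) (hp : 2 ≤ p)
    (hα : α ∈ Set.Ioo (0 : ℝ) 1) (hε : ε ∈ Set.Ioo (0 : ℝ) 1)
    (hnpα : p * α < (n : ℝ))
    (hΩo : IsOpen Ω) (hΩconn : IsConnected Ω) (hΩbdd : Bornology.IsBounded Ω)
    (s : ℝ) (hs : 0 ≤ s)
    (u : ℕ → Pt n → ℝ) (t : ℕ → ℝ) (η : ℕ → ℝ) (K : ℝ) (hK : 0 < K)
    (hS : ∀ k, sphereS p α ε Ω (u k))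
    (hη : Filter.Tendsto η Filter.atTop (nhds 0))
    (hJ : ∀ k, |Jfun p α ε s Ω (u k)| ≤ K)
    (hder : ∀ k, ∀ v, memW p α Ω v →
      |Lam n p * (1 - α) * Hform p α Ω (u k) v
          + (∫ x in Ω, |u k x| ^ (p - 2) * u k x * v x)
          - (s / ε) * (∫ x in Oeps Ω ε, pPart (u k) x ^ (p - 1) * v x)
          - (t k / ε) * ∫ x in Oeps Ω ε, |u k x| ^ (p - 2) * u k x * v x|
        ≤ η k * normW p α Ω v) :
    ∃ ψ : ℕ → ℕ, StrictMono ψ ∧ ∃ ulim, memW p α Ω ulim ∧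
      Filter.Tendsto (fun k => normW p α Ω (u (ψ k) - ulim)) Filter.atTop (nhds 0) := by
  obtain ⟨hα0, hα1⟩ := hα
  obtain ⟨hε0, hε1⟩ := hε
  have hp0 : (0 : ℝ) < p := by linarith
  have hΛ : 0 < Lam n p * (1 - α) := mul_pos (ps_Lam_pos hn hp) (by linarith)
  set Λ := Lam n p * (1 - α) with hΛdef
  have hDΩ : Oeps Ω ε ⊆ Ω := fun x hx => hx.1
  have hW : ∀ k, memW p α Ω (u k) := fun k => (hS k).1
  have hm : ∀ k, Measurable (u k) := fun k => (hW k).1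
  have hSε : ∀ k, ∫ x in Oeps Ω ε, |u k x| ^ p = ε := by
    intro k
    have := (hS k).2
    field_simp at this
    linarith
  have hl0 : ∀ f : Pt n → ℝ, 0 ≤ lpP p Ω f := fun f =>
    integral_nonneg fun x => by positivity
  have hg0 : ∀ f : Pt n → ℝ, 0 ≤ gagP p α Ω f := fun f =>
    integral_nonneg fun z => mul_nonneg (by positivity) (ps_kern_nonneg _ _ _)
  have hE : ∀ k, Λ * gagP p α Ω (u k) + lpP p Ω (u k) ≤ K + s := by
    intro k
    have h1 := (abs_le.1 (hJ k)).2
    unfold Jfun energy at h1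
    have h2 : ∫ x in Oeps Ω ε, pPart (u k) x ^ p ≤ ε := by
      refine le_trans ?_ (hSε k).le
      refine integral_mono_of_nonneg ?_
        ((ps_intA (hW k)).mono_measure (Measure.restrict_mono hDΩ le_rfl)) ?_
      · exact Filter.Eventually.of_forall fun x => Real.rpow_nonneg (ps_ple _ _).1 _
      · exact Filter.Eventually.of_forall fun x =>
          Real.rpow_le_rpow (ps_ple _ _).1 (ps_ple _ _).2 hp0.le
    have h3 : (s / ε) * ∫ x in Oeps Ω ε, pPart (u k) x ^ p ≤ (s / ε) * ε := by gcongr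
    rw [div_mul_cancel₀ _ hε0.ne'] at h3
    linarith
  set M0 := (K + s) * (1 + 1 / Λ) with hM0
  have hKs : 0 < K + s := by linarith
  have hM0p : 0 < M0 := by positivity
  have hlM : ∀ k, lpP p Ω (u k) ≤ M0 := by
    intro k
    have h1 := hE k
    have h2 : 0 ≤ Λ * gagP p α Ω (u k) := mul_nonneg hΛ.le (hg0 _)
    have h3 : 0 ≤ (K + s) * (1 / Λ) := by positivity
    rw [hM0, mul_add, mul_one]
    linarith
  have hgM : ∀ k, gagP p α Ω (u k) ≤ M0 := by
    intro k
    have h1 := hE k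
    have h2 := hl0 (u k)
    have h3 : gagP p α Ω (u k) ≤ (K + s) * (1 / Λ) := by
      rw [mul_one_div, le_div_iff₀ hΛ]
      linarith
    rw [hM0, mul_add, mul_one]
    linarith
  have hnorm : ∀ (f : Pt n → ℝ) (X : ℝ), lpP p Ω f ≤ X → gagP p α Ω f ≤ X →
      normW p α Ω f ≤ (2 * X) ^ (1 / p) := by
    intro f X h1 h2
    unfold normW
    exact Real.rpow_le_rpow (add_nonneg (hl0 f) (hg0 f)) (by linarith) (by positivity)
  obtain ⟨E, hEη⟩ : ∃ E, ∀ k, |η k| ≤ E := by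
    obtain ⟨E, hE⟩ := hη.abs.bddAbove_range
    exact ⟨E, fun k => hE ⟨k, rfl⟩⟩
  have hE0 : 0 ≤ E := (abs_nonneg _).trans (hEη 0)
  set T := K + E * (2 * M0) ^ (1 / p) with hT
  have hT0 : 0 ≤ T := by positivity
  have htT : ∀ k, |t k| ≤ T := by
    intro k
    have h := hder k (u k) (hW k)
    have e1 : Hform p α Ω (u k) (u k) = gagP p α Ω (u k) := by
      unfold Hform gagP
      congr 1
      ext z
      rw [ps_gmul hp]
    have e2 : (∫ x in Oeps Ω ε, |u k x| ^ (p - 2) * u k x * u k x) = ε := by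
      refine Eq.trans ?_ (hSε k)
      congr 1
      ext x
      rw [ps_gmul hp]
    have e3 : (∫ x in Ω, |u k x| ^ (p - 2) * u k x * u k x) = lpP p Ω (u k) := by
      unfold lpP
      congr 1
      ext x
      rw [ps_gmul hp]
    simp only [ps_ppow hp] at h
    rw [e1, e2, e3, div_mul_cancel₀ _ hε0.ne'] at h
    have h1 := hJ k
    unfold Jfun energy at h1
    have h2 : η k * normW p α Ω (u k) ≤ E * (2 * M0) ^ (1 / p) := by
      have h3 := hnorm _ _ (hlM k) (hgM k)
      have h4 : 0 ≤ normW p α Ω (u k) :=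
        Real.rpow_nonneg (add_nonneg (hl0 _) (hg0 _)) _
      exact mul_le_mul ((le_abs_self _).trans (hEη k)) h3 h4 hE0
    have h5 := abs_le.1 (h.trans h2)
    have h6 := abs_le.1 h1
    rw [← hΛdef] at h6
    rw [abs_le, hT]
    constructor <;> linarith [h5.1, h5.2, h6.1, h6.2]
  have hAA : ∀ k, AA p Ω (u k) ≤ ENNReal.ofReal M0 := by
    intro k
    rw [← ENNReal.ofReal_toReal (ps_memW.1 (hW k)).2.1.ne, ← ps_lpP (hm k)]
    exact ENNReal.ofReal_le_ofReal (hlM k)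
  have hGG : ∀ k, GG p α Ω (u k) ≤ ENNReal.ofReal M0 := by
    intro k
    rw [← ENNReal.ofReal_toReal (ps_memW.1 (hW k)).2.2.ne, ← ps_gagP (hm k)]
    exact ENNReal.ofReal_le_ofReal (hgM k)
  obtain ⟨ψ, hψ, hcau⟩ := ps_compact hp hα0 hΩo hΩconn.nonempty hΩbdd u hm _
    ENNReal.ofReal_ne_top hAA hGG
  refine ⟨ψ, hψ, ps_complete hp hΩo hΩconn.nonempty (fun k => u (ψ k)) (fun k => hW _) ?_⟩
  set C := 1 + s / ε + T / ε with hC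
  have hC0 : 0 < C := by positivity
  have hHest : ∀ k v d, memW p α Ω v → 0 < d →
      |Λ * Hform p α Ω (u k) v| ≤ |η k| * normW p α Ω v +
        C * (d * M0 + d ^ (1 - p) * lpP p Ω v) := by
    intro k v d hv hd
    have hN : 0 ≤ normW p α Ω v := Real.rpow_nonneg (add_nonneg (hl0 _) (hg0 _)) _
    have h := (hder k v hv).trans (mul_le_mul_of_nonneg_right (le_abs_self (η k)) hN)
    set X := d * M0 + d ^ (1 - p) * lpP p Ω v with hX
    have hle : d * lpP p Ω (u k) + d ^ (1 - p) * lpP p Ω v ≤ X := by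
      have := hlM k
      rw [hX]
      gcongr
    have hX0 : 0 ≤ X := by
      have := hl0 v
      positivity
    have b1 : |∫ x in Ω, |u k x| ^ (p - 2) * u k x * v x| ≤ X :=
      (ps_gbound hp hd subset_rfl (hW k) hv fun x => (ps_absg hp).le).trans hle
    have b2 : |∫ x in Oeps Ω ε, |u k x| ^ (p - 2) * u k x * v x| ≤ X :=
      (ps_gbound hp hd hDΩ (hW k) hv fun x => (ps_absg hp).le).trans hle
    have b3 : |∫ x in Oeps Ω ε, pPart (u k) x ^ (p - 1) * v x| ≤ X := by
      refine (ps_gbound hp hd hDΩ (hW k) hv fun x => ?_).trans hle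
      rw [abs_of_nonneg (Real.rpow_nonneg (ps_ple _ _).1 _)]
      exact Real.rpow_le_rpow (ps_ple _ _).1 (ps_ple _ _).2 (by linarith)
    have b4 : |(t k / ε) * ∫ x in Oeps Ω ε, |u k x| ^ (p - 2) * u k x * v x| ≤ T / ε * X := by
      rw [abs_mul, abs_div, abs_of_pos hε0]
      have := htT k
      gcongr
    have b5 : |(s / ε) * ∫ x in Oeps Ω ε, pPart (u k) x ^ (p - 1) * v x| ≤ s / ε * X := by
      rw [abs_mul, abs_of_nonneg (by positivity : 0 ≤ s / ε)]
      gcongr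
    have h' := abs_le.1 h
    have b1' := abs_le.1 b1
    have b4' := abs_le.1 b4
    have b5' := abs_le.1 b5
    have eC : C * X = X + s / ε * X + T / ε * X := by rw [hC]; ring
    rw [abs_le, eC]
    constructor
    · linarith [h'.1, h'.2, b1'.1, b1'.2, b4'.1, b4'.2, b5'.1, b5'.2]
    · linarith [h'.1, h'.2, b1'.1, b1'.2, b4'.1, b4'.2, b5'.1, b5'.2]
  intro δ hδ
  obtain ⟨r, hr0, hrδ⟩ : ∃ r : ℝ, 0 < r ∧ ENNReal.ofReal r ≤ δ := by
    have h1 : min δ 1 ≠ ⊤ := ne_top_of_le_ne_top ENNReal.one_ne_top (min_le_right _ _)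
    refine ⟨(min δ 1).toReal, ENNReal.toReal_pos (lt_min hδ one_pos).ne' h1, ?_⟩
    rw [ENNReal.ofReal_toReal h1]
    exact min_le_left _ _
  set c := Λ * 2 ^ (1 - p) with hc
  have hc0 : 0 < c := by positivity
  set M2 := (2 * (2 ^ p * (M0 + M0))) ^ (1 / p) with hM2
  have hM20 : 0 ≤ M2 := by positivity
  set d := c * r / (6 * C * (M0 + 1)) with hd
  have hd0 : 0 < d := by positivity
  set ρ := c * r / (6 * C * d ^ (1 - p)) with hρ
  have hρ0 : 0 < ρ := by positivity
  have hσ : 0 < c * r / (6 * (M2 + 1)) := by positivity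
  obtain ⟨N1, hN1⟩ := hcau (min δ (ENNReal.ofReal ρ)) (lt_min hδ (ENNReal.ofReal_pos.2 hρ0))
  have hηev : ∀ᶠ k in atTop, |η (ψ k)| < c * r / (6 * (M2 + 1)) := by
    have h1 := (hη.comp hψ.tendsto_atTop).abs
    rw [abs_zero] at h1
    exact h1.eventually_lt_const hσ
  obtain ⟨N2, hN2⟩ := eventually_atTop.1 hηev
  refine ⟨max N1 N2, fun k hk l hl => ?_⟩
  have hA := hN1 k ((le_max_left _ _).trans hk) l ((le_max_left _ _).trans hl)
  refine ⟨hA.trans (min_le_left _ _), ?_⟩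
  have hv : memW p α Ω (u (ψ k) - u (ψ l)) := ps_memW_sub hp (hW _) (hW _)
  set v := u (ψ k) - u (ψ l) with hvdef
  have hlv : lpP p Ω v ≤ ρ := by
    rw [ps_lpP hv.1]
    exact ENNReal.toReal_le_of_le_ofReal hρ0.le (hA.trans (min_le_right _ _))
  have h2p : (0 : ℝ) < 2 ^ p := by positivity
  have hNv : normW p α Ω v ≤ M2 := by
    refine hnorm v _ ?_ ?_
    · refine (ps_lpP_sub hp (hW _) (hW _)).trans ?_
      have h1 := hlM (ψ k)
      have h2 := hlM (ψ l)
      gcongr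
    · refine (ps_gagP_sub hp (hW _) (hW _)).trans ?_
      have h1 := hgM (ψ k)
      have h2 := hgM (ψ l)
      gcongr
  have hNv0 : 0 ≤ normW p α Ω v := Real.rpow_nonneg (add_nonneg (hl0 _) (hg0 _)) _
  have hmono := mul_le_mul_of_nonneg_left (ps_Hmono hp (hW (ψ k)) (hW (ψ l))) hΛ.le
  rw [← hvdef, ← mul_assoc, ← hc, mul_sub] at hmono
  have hk1 := (abs_le.1 (hHest (ψ k) v d hv hd0)).2
  have hl1 := (abs_le.1 (hHest (ψ l) v d hv hd0)).1
  have hηb : ∀ j ≥ max N1 N2, |η (ψ j)| * normW p α Ω v ≤ c * r / 6 := by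
    intro j hj
    have h1 := (hN2 j ((le_max_right _ _).trans hj)).le
    calc |η (ψ j)| * normW p α Ω v ≤ c * r / (6 * (M2 + 1)) * (M2 + 1) :=
          mul_le_mul h1 (by linarith) hNv0 hσ.le
      _ = c * r / 6 := by field_simp
  have hk2 := hηb k hk
  have hl2 := hηb l hl
  have hCd : C * (d * M0 + d ^ (1 - p) * lpP p Ω v) ≤ c * r / 3 := by
    have hdp : 0 < d ^ (1 - p) := by positivity
    have h1 : C * (d * M0) ≤ c * r / 6 := by
      calc C * (d * M0) ≤ C * (d * (M0 + 1)) := by gcongr; linarith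
        _ = c * r / 6 := by
          have : d * (M0 + 1) = c * r / (6 * C) := by
            rw [hd]; field_simp
          rw [this]; field_simp
    have h2 : C * (d ^ (1 - p) * lpP p Ω v) ≤ c * r / 6 := by
      calc C * (d ^ (1 - p) * lpP p Ω v) ≤ C * (d ^ (1 - p) * ρ) := by gcongr
        _ = c * r / 6 := by
          rw [hρ]; field_simp
    rw [mul_add]
    linarith
  have hfin : c * gagP p α Ω v ≤ c * r := by linarith
  have hfin2 : gagP p α Ω v ≤ r := le_of_mul_le_mul_left hfin hc0
  refine le_trans ?_ hrδ
  rw [← ENNReal.ofReal_toReal (ps_memW.1 hv).2.2.ne, ← ps_gagP hv.1]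
  exact ENNReal.ofReal_le_ofReal hfin2
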